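/- If G is a finite simple graph on n vertices such that for every vertex set S, the number of odd components of G \ S minus |S| is at most c·n − d (for constants c, d), then G has a matching of size at least ((1−c)/2)·n + d/2. -/

import Mathlib

open SimpleGraph

/-- Number of odd connected components of the graph induced on the complement of `S`. -/
noncomputable def oddComp {V : Type*} (G : SimpleGraph V) (S : Set V) : ℕ :=
  Nat.card {c : (G.induce Sᶜ).ConnectedComponent // Odd (Nat.card c.supp)}

/-- A 1-planar drawing of a graph: vertices are points in the plane, edges are
simple curves between their endpoints avoiding other vertices, and every edge
contains at most one crossing point with other edges. -/
structure OnePlanarDrawing {V : Type*} (G : SimpleGraph V) where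
  vert : V → ℝ × ℝ
  vert_inj : Function.Injective vert
  curve : G.edgeSet → ℝ → ℝ × ℝ
  curve_cont : ∀ e, ContinuousOn (curve e) (Set.Icc 0 1)
  curve_inj : ∀ e, Set.InjOn (curve e) (Set.Icc 0 1)
  curve_ends : ∀ (e : G.edgeSet) (u v : V), (e : Sym2 V) = s(u, v) →
    ({curve e 0, curve e 1} : Set (ℝ × ℝ)) = {vert u, vert v}
  interior_avoid : ∀ (e : G.edgeSet), ∀ t ∈ Set.Ioo (0:ℝ) 1, ∀ v, curve e t ≠ vert v
  one_cross : ∀ e : G.edgeSet,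
    Set.Subsingleton {p : ℝ × ℝ | ∃ f : G.edgeSet, f ≠ e ∧
      p ∈ curve e '' Set.Ioo (0:ℝ) 1 ∧ p ∈ curve f '' Set.Ioo (0:ℝ) 1}

/-- A graph is 1-planar if it admits a 1-planar drawing. -/
def OnePlanar {V : Type*} (G : SimpleGraph V) : Prop := Nonempty (OnePlanarDrawing G)

/-- An edge is crossed in a drawing if its interior meets the interior of another edge. -/
def OnePlanarDrawing.Crossed {V : Type*} {G : SimpleGraph V} (D : OnePlanarDrawing G)
    (e : G.edgeSet) : Prop :=
  ∃ f : G.edgeSet, f ≠ e ∧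
    (D.curve e '' Set.Ioo (0:ℝ) 1 ∩ D.curve f '' Set.Ioo (0:ℝ) 1).Nonempty

namespace SimpleGraph

variable {V W : Type*}

/-- The join of two graphs: their disjoint sum together with all edges between the two sides. -/
def joinSum (G : SimpleGraph V) (H : SimpleGraph W) : SimpleGraph (V ⊕ W) :=
  (G ⊕g H) ⊔ completeBipartiteGraph V W

section joinSum

variable {G : SimpleGraph V} {H : SimpleGraph W}

@[simp]
lemma joinSum_adj_inl_inl {u v : V} : (G.joinSum H).Adj (.inl u) (.inl v) ↔ G.Adj u v := by
  simp [joinSum]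

@[simp]
lemma joinSum_adj_inr_inr {u v : W} : (G.joinSum H).Adj (.inr u) (.inr v) ↔ H.Adj u v := by
  simp [joinSum]

@[simp]
lemma joinSum_adj_inl_inr {u : V} {v : W} : (G.joinSum H).Adj (.inl u) (.inr v) := by
  simp [joinSum]

@[simp]
lemma joinSum_adj_inr_inl {u : W} {v : V} : (G.joinSum H).Adj (.inr u) (.inl v) := by
  simp [joinSum]

end joinSum

lemma oddComp_eq_ncard (G : SimpleGraph V) (S : Set V) :
    oddComp G S = (G.induce Sᶜ).oddComponents.ncard := rfl

lemma Iso.ncard_oddComponents_eq {G : SimpleGraph V} {H : SimpleGraph W} (φ : G ≃g H) :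
    G.oddComponents.ncard = H.oddComponents.ncard := by
  simp only [← Nat.card_coe_set_eq]
  refine Nat.card_congr (φ.connectedComponentEquiv.subtypeEquiv fun C ↦ ?_)
  change Odd C.supp.ncard ↔ Odd (φ.connectedComponentEquiv C).supp.ncard
  rw [← Nat.card_coe_set_eq, ← Nat.card_coe_set_eq,
    Nat.card_congr (ConnectedComponent.isoEquivSupp φ C)]

/-- Deleting vertices as a subgraph operation agrees with inducing on the complement. -/
def deleteVertsTopCoeIso (G : SimpleGraph V) (S : Set V) :
    ((⊤ : G.Subgraph).deleteVerts S).coe ≃g G.induce Sᶜ where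
  toEquiv := Equiv.subtypeEquivRight fun v ↦ by simp
  map_rel_iff' := by
    rintro ⟨u, -, hu⟩ ⟨v, -, hv⟩
    simp [hu, hv]

lemma isTutteViolator_iff_oddComp {G : SimpleGraph V} {S : Set V} :
    G.IsTutteViolator S ↔ S.ncard < oddComp G S := by
  rw [IsTutteViolator, oddComp_eq_ncard, (G.deleteVertsTopCoeIso S).ncard_oddComponents_eq]

/-- Deleting from a join a set containing the whole right side leaves an induced subgraph of the
left side. -/
noncomputable def induceComplIsoJoinSum (G : SimpleGraph V) (H : SimpleGraph W) {U : Set (V ⊕ W)}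
    (hU : ∀ w, .inr w ∈ U) :
    G.induce (Sum.inl ⁻¹' U)ᶜ ≃g (G.joinSum H).induce Uᶜ where
  toEquiv := Equiv.ofBijective (fun v ↦ ⟨.inl v.1, v.2⟩) <| by
    refine ⟨fun u v h ↦ by simpa [Subtype.ext_iff] using h, ?_⟩
    rintro ⟨v | w, hv⟩
    · exact ⟨⟨v, hv⟩, rfl⟩
    · exact absurd (hU w) hv
  map_rel_iff' := joinSum_adj_inl_inl

lemma oddComp_joinSum (G : SimpleGraph V) (H : SimpleGraph W) {U : Set (V ⊕ W)}
    (hU : ∀ w, .inr w ∈ U) :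
    oddComp (G.joinSum H) U = oddComp G (Sum.inl ⁻¹' U) := by
  rw [oddComp_eq_ncard, oddComp_eq_ncard, (induceComplIsoJoinSum G H hU).ncard_oddComponents_eq]

lemma odd_oddComp_iff [Finite V] (G : SimpleGraph V) (S : Set V) :
    Odd (oddComp G S) ↔ Odd (Nat.card V + S.ncard) := by
  rw [oddComp_eq_ncard, odd_ncard_oddComponents, Nat.card_coe_set_eq, ← S.ncard_add_ncard_compl]
  grind

lemma Preconnected.oddComp_le_one {G : SimpleGraph V} {S : Set V}
    (h : (G.induce Sᶜ).Preconnected) : oddComp G S ≤ 1 := by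
  have := h.subsingleton_connectedComponent
  exact Finite.card_le_one_iff_subsingleton.mpr inferInstance

lemma preconnected_joinSum_top_induce_compl (G : SimpleGraph V) {U : Set (V ⊕ W)} {w : W}
    (hw : .inr w ∉ U) : ((G.joinSum (⊤ : SimpleGraph W)).induce Uᶜ).Preconnected := by
  have key (x : ↥Uᶜ) : ((G.joinSum (⊤ : SimpleGraph W)).induce Uᶜ).Reachable ⟨.inr w, hw⟩ x := by
    obtain ⟨v | w', hx⟩ := x
    · exact Adj.reachable (by simp)
    · by_cases h : w = w'
      · subst h; rfl
      · exact Adj.reachable (by simpa using h)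
  exact fun x y ↦ (key x).symm.trans (key y)

/-- If every deficiency of `G` is at most `Nat.card W`, then joining `G` with the complete graph
on `W` produces a graph with a perfect matching, provided the parities agree. -/
lemma exists_isPerfectMatching_joinSum_top [Finite V] [Finite W] (G : SimpleGraph V)
    (heven : Even (Nat.card V + Nat.card W)) (h : ∀ S, oddComp G S ≤ S.ncard + Nat.card W) :
    ∃ M : (G.joinSum (⊤ : SimpleGraph W)).Subgraph, M.IsPerfectMatching := by
  refine tutte.mpr fun U ↦ ?_
  rw [isTutteViolator_iff_oddComp, not_lt]
  by_cases! hU : ∀ w, .inr w ∈ U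
  · rw [oddComp_joinSum G ⊤ hU]
    refine (h _).trans_eq ?_
    have hdecomp : U = Sum.inl '' (Sum.inl ⁻¹' U) ∪ Set.range (Sum.inr : W → V ⊕ W) := by
      ext (v | w) <;> simp [hU]
    conv_rhs => rw [hdecomp]
    rw [Set.ncard_union_eq, Set.ncard_image_of_injective _ Sum.inl_injective, ← Set.image_univ,
      Set.ncard_image_of_injective _ Sum.inr_injective, Set.ncard_univ]
    exact Set.disjoint_left.mpr (by simp)
  · obtain ⟨w, hw⟩ := hU
    have hle := (preconnected_joinSum_top_induce_compl G hw).oddComp_le_one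
    have hodd := odd_oddComp_iff (G.joinSum (⊤ : SimpleGraph W)) U
    rw [Nat.card_sum] at hodd
    by_contra! hlt
    grind

lemma Subgraph.IsMatching.ncard_verts_le [Finite V] {G : SimpleGraph V} {M : G.Subgraph}
    (hM : M.IsMatching) : M.verts.ncard ≤ 2 * M.edgeSet.ncard := by
  classical
  cases nonempty_fintype V
  have hverts : M.verts = ↑(M.edgeSet.toFinite.toFinset.biUnion Sym2.toFinset) := by
    rw [hM.verts_eq_biUnion_edgeSet]
    ext
    simp
  rw [hverts, Set.ncard_coe_finset, Set.ncard_eq_toFinset_card _ M.edgeSet.toFinite, mul_comm]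
  refine Finset.card_biUnion_le_card_mul _ _ _ fun e _ ↦ ?_
  rw [Sym2.card_toFinset]
  split_ifs <;> simp

/-- The edges of a matching of a join that lie inside the left side. -/
def Subgraph.leftOfJoinSum {G : SimpleGraph V} {H : SimpleGraph W}
    (M : (G.joinSum H).Subgraph) : G.Subgraph where
  verts := {v | ∃ w, M.Adj (.inl v) (.inl w)}
  Adj u v := M.Adj (.inl u) (.inl v)
  adj_sub h := joinSum_adj_inl_inl.mp h.adj_sub
  edge_vert h := ⟨_, h⟩
  symm.symm _ _ h := h.symm

lemma Subgraph.IsMatching.leftOfJoinSum {G : SimpleGraph V} {H : SimpleGraph W}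
    {M : (G.joinSum H).Subgraph} (hM : M.IsMatching) : M.leftOfJoinSum.IsMatching :=
  fun _ ⟨w, hw⟩ ↦ ⟨w, hw, fun _ hy ↦ Sum.inl_injective (hM.eq_of_adj_left hy hw)⟩

lemma Subgraph.IsPerfectMatching.card_le_ncard_verts_leftOfJoinSum [Finite V] [Finite W]
    {G : SimpleGraph V} {H : SimpleGraph W} {M : (G.joinSum H).Subgraph}
    (hM : M.IsPerfectMatching) :
    Nat.card V ≤ M.leftOfJoinSum.verts.ncard + Nat.card W := by
  have hpartner (v : ↥M.leftOfJoinSum.vertsᶜ) : ∃ w : W, M.Adj (.inl v.1) (.inr w) := by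
    obtain ⟨x | w, hx, -⟩ := hM.1 (hM.2 (.inl v.1))
    · exact absurd ⟨x, hx⟩ v.2
    · exact ⟨w, hx⟩
  choose f hf using hpartner
  have hinj : f.Injective := fun u v huv ↦
    Subtype.ext (Sum.inl_injective (hM.1.eq_of_adj_right (hf u) (huv ▸ hf v)))
  rw [← M.leftOfJoinSum.verts.ncard_add_ncard_compl]
  exact Nat.add_le_add_left (Nat.card_le_card_of_injective f hinj) _

/-- The nontrivial direction of the **Tutte–Berge formula**: some set `S` certifies the
optimality of some matching. -/
theorem exists_isMatching_add_oddComp_le [Finite V] (G : SimpleGraph V) :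
    ∃ (S : Set V) (M : G.Subgraph), M.IsMatching ∧
      Nat.card V + S.ncard ≤ 2 * M.edgeSet.ncard + oddComp G S := by
  obtain ⟨S, hS⟩ := Finite.exists_max fun S : Set V ↦ (oddComp G S : ℤ) - S.ncard
  have hempty := hS ∅
  obtain ⟨k, hk⟩ : ∃ k : ℕ, oddComp G S = S.ncard + k := by
    refine Nat.exists_eq_add_of_le ?_
    simp at hempty
    lia
  have hodd := odd_oddComp_iff G S
  obtain ⟨M, hM⟩ := exists_isPerfectMatching_joinSum_top (W := Fin k) G
    (by rw [Nat.card_fin]; grind) (fun T ↦ by have := hS T; rw [Nat.card_fin]; lia)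
  refine ⟨S, M.leftOfJoinSum, hM.1.leftOfJoinSum, ?_⟩
  have hcard := hM.card_le_ncard_verts_leftOfJoinSum
  have hedges := hM.1.leftOfJoinSum.ncard_verts_le
  rw [Nat.card_fin] at hcard
  lia

end SimpleGraph

theorem stmt0 {V : Type*} [Fintype V] (G : SimpleGraph V) (c d : ℚ)
    (h : ∀ S : Set V, (oddComp G S : ℚ) - Nat.card S ≤ c * Fintype.card V - d) :
    ∃ M : G.Subgraph, M.IsMatching ∧
      (1 - c) / 2 * Fintype.card V + d / 2 ≤ (M.edgeSet.ncard : ℚ) := by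
  obtain ⟨S, M, hM, hle⟩ := G.exists_isMatching_add_oddComp_le
  refine ⟨M, hM, ?_⟩
  have hS := h S
  rw [Nat.card_coe_set_eq] at hS
  rw [Nat.card_eq_fintype_card] at hle
  have hle' : (Fintype.card V + S.ncard : ℚ) ≤ 2 * M.edgeSet.ncard + oddComp G S := mod_cast hle
  linarith
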